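/- Let λ > 0 and let X be a solution of (GF2) on an interval [0,T), C¹ as a map into W^{1,1}, with L₀ := L(X(·,0)). Then for all t ∈ [0,T): L(X(·,t)) ≤ L₀ e^{-4t/(1 + 8λ²)}. -/

import Mathlib

open MeasureTheory Real Filter Function Set intervalIntegral
open scoped RealInnerProductSpace Topology ENNReal

noncomputable section

/-- The plane with the Euclidean norm and inner product. -/
abbrev R2 := EuclideanSpace ℝ (Fin 2)

/-- Construct a point of the plane from two coordinates. -/
def mk2 (a b : ℝ) : R2 := (WithLp.equiv 2 (Fin 2 → ℝ)).symm ![a, b]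

/-- The length of a curve, computed from its (weak) derivative `g`:
`L(γ) = ∫₀¹ |γ'(u)| du`. -/
def clen (g : ℝ → R2) : ℝ := ∫ u in (0:ℝ)..1, ‖g u‖

/-- Normalised arc length `ξ_γ(u) = L(γ)⁻¹ ∫₀ᵘ |γ'(τ)| dτ`, from the derivative `g`. -/
def carc (g : ℝ → R2) (u : ℝ) : ℝ := (clen g)⁻¹ * ∫ τ in (0:ℝ)..u, ‖g τ‖

/-- The periodic Green's function kernel
`G^λ(x) = -cosh((|x| - 1/2)/λ) / (2λ sinh(1/(2λ)))`. -/
def Gker (lam x : ℝ) : ℝ := -(Real.cosh ((|x| - 1/2)/lam) / (2*lam*Real.sinh (1/(2*lam))))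

/-- The `γ`-convolution `(f ∗_γ G^λ)(u) = ∫₀¹ f(v) G^λ(ξ_γ(v) - ξ_γ(u)) (|γ'(v)|/L(γ)) dv`,
where `g` is the derivative of the underlying curve. -/
def convG (lam : ℝ) (g f : ℝ → R2) (u : ℝ) : R2 :=
  ∫ v in (0:ℝ)..1, (Gker lam (carc g v - carc g u) * (‖g v‖ / clen g)) • f v

/-- Minus the `H¹_{λ,a}` gradient of length:
`F_{λ,a}(γ) = -(L(γ)^{a-2}/λ²)(γ + γ ∗_γ G^λ)` when `L(γ) ≠ 0`, and `0` otherwise. -/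
def Fgrad (lam a : ℝ) (γ g : ℝ → R2) (u : ℝ) : R2 :=
  if clen g = 0 then 0 else (-((clen g ^ (a-2)) / lam^2)) • (γ u + convG lam g γ u)

/-- `γ` is a 1-periodic `W^{1,1}` curve with (weak) derivative `g`. -/
def IsW11 (γ g : ℝ → R2) : Prop :=
  Periodic γ 1 ∧ Periodic g 1 ∧ LocallyIntegrable g volume ∧
    ∀ u, γ u = γ 0 + ∫ τ in (0:ℝ)..u, g τ

/-- `X` (with spatial derivatives `g`) solves the gradient flow (GFa) on the time set `I`:
each `X t` is a `W^{1,1}` curve and `∂ₜ X(u,t) = F_{λ,a}(X(·,t))(u)`. -/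
def IsGFSol (lam a : ℝ) (I : Set ℝ) (X g : ℝ → ℝ → R2) : Prop :=
  (∀ t ∈ I, IsW11 (X t) (g t)) ∧
  ∀ t ∈ I, ∀ u, HasDerivWithinAt (fun s => X s u) (Fgrad lam a (X t) (g t) u) I t

/-- The `W^{1,1}` distance between the curves `(γ, g)` and `(β, h)`. -/
def W11dist (γ g β h : ℝ → R2) : ℝ :=
  (∫ u in (0:ℝ)..1, ‖γ u - β u‖) + ∫ u in (0:ℝ)..1, ‖g u - h u‖

/-- The family `t ↦ (X t, g t)` is `C¹` as a map into `W^{1,1}`, with time-derivative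
family `(D t, Dg t)`: the difference quotients converge in the `W^{1,1}` norm and the
derivative family is continuous in the `W^{1,1}` norm. -/
def IsC1W11 (I : Set ℝ) (X g D Dg : ℝ → ℝ → R2) : Prop :=
  (∀ t ∈ I, Tendsto (fun h : ℝ =>
      W11dist (fun u => X (t+h) u - h • D t u) (fun u => g (t+h) u - h • Dg t u)
        (X t) (g t) / |h|)
      (nhdsWithin (0:ℝ) {h : ℝ | t + h ∈ I ∧ h ≠ 0}) (𝓝 0)) ∧
  (∀ t ∈ I, Tendsto (fun s => W11dist (D s) (Dg s) (D t) (Dg t)) (𝓝[I] t) (𝓝 0))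

/-- `p i` are continuous functions on `[0,S]` with nonnegative supremum `l`, whose increments are
controlled by upper bounds of `l`. -/
structure SupControlled (p : ℕ → ℝ → ℝ) (l : ℝ → ℝ) (k S : ℝ) : Prop where
  k_nonneg : 0 ≤ k
  cont : ∀ i, ContinuousOn (p i) (Icc 0 S)
  lub : ∀ t ∈ Icc 0 S, IsLUB (range fun i => p i t) (l t)
  nonneg : ∀ t ∈ Icc 0 S, 0 ≤ l t
  incr : ∀ s ∈ Icc 0 S, ∀ t ∈ Icc 0 S, ∀ M, (∀ r ∈ uIcc s t, l r ≤ M) →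
    ∀ i, p i t - p i s ≤ k * M * |t - s|

namespace SupControlled

variable {p : ℕ → ℝ → ℝ} {l : ℝ → ℝ} {k S : ℝ}

lemma sup_incr (h : SupControlled p l k S) {s t M : ℝ} (hs : s ∈ Icc 0 S) (ht : t ∈ Icc 0 S)
    (hM : ∀ r ∈ uIcc s t, l r ≤ M) : l t - l s ≤ k * M * |t - s| := by
  have : l t ≤ l s + k * M * |t - s| := by
    apply (h.lub t ht).2
    rintro _ ⟨i, rfl⟩
    have h1 := h.incr s hs t ht M hM i
    have h2 := (h.lub s hs).1 ⟨i, rfl⟩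
    simp only at h2 ⊢
    linarith
  linarith

lemma le_two_mul (h : SupControlled p l k S) {s t : ℝ} (hs : s ∈ Icc 0 S) (ht : t ∈ Icc 0 S)
    (hst : 2 * k * |t - s| ≤ 1) (hb : ∃ M, ∀ r ∈ uIcc s t, l r ≤ M) :
    l t ≤ 2 * l s := by
  have hsub : uIcc s t ⊆ Icc 0 S := ordConnected_Icc.uIcc_subset hs ht
  obtain ⟨M₀, hM₀⟩ := hb
  have hbdd : BddAbove (l '' uIcc s t) := ⟨M₀, by rintro _ ⟨r, hr, rfl⟩; exact hM₀ r hr⟩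
  set M := sSup (l '' uIcc s t)
  have hM : ∀ r ∈ uIcc s t, l r ≤ M := fun r hr => le_csSup hbdd ⟨r, hr, rfl⟩
  have hMn : 0 ≤ M := (h.nonneg s hs).trans (hM s left_mem_uIcc)
  have : M ≤ l s + M / 2 := by
    apply csSup_le (Set.Nonempty.image l ⟨s, left_mem_uIcc⟩)
    rintro _ ⟨r, hr, rfl⟩
    have h1 := h.sup_incr hs (hsub hr) (M := M)
      (fun x hx => hM x (uIcc_subset_uIcc_left hr hx))
    have h2 : |r - s| ≤ |t - s| := abs_sub_left_of_mem_uIcc hr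
    have h3 : k * M * |r - s| ≤ k * M * |t - s| :=
      mul_le_mul_of_nonneg_left h2 (mul_nonneg h.k_nonneg hMn)
    nlinarith
  linarith [hM t right_mem_uIcc]

/-- The points near which `l` is bounded above. -/
def locBdd (l : ℝ → ℝ) (S : ℝ) : Set ℝ :=
  {t | ∃ M, ∀ᶠ r in 𝓝 t, r ∈ Icc 0 S → l r ≤ M}

lemma isOpen_locBdd (l : ℝ → ℝ) (S : ℝ) : IsOpen (locBdd l S) := by
  rw [isOpen_iff_mem_nhds]
  rintro t ⟨M, hM⟩
  filter_upwards [hM.eventually_nhds] with x hx using ⟨M, hx⟩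

lemma exists_bound_of_subset_locBdd {s t : ℝ} (hs : s ∈ Icc 0 S) (ht : t ∈ Icc 0 S)
    (hU : uIcc s t ⊆ locBdd l S) : ∃ M, ∀ r ∈ uIcc s t, l r ≤ M := by
  have hsub : uIcc s t ⊆ Icc 0 S := ordConnected_Icc.uIcc_subset hs ht
  refine isCompact_uIcc.induction_on (p := fun A => ∃ M, ∀ r ∈ A, l r ≤ M) ⟨0, by simp⟩
    (fun A B hAB ⟨M, hM⟩ => ⟨M, fun r hr => hM r (hAB hr)⟩) ?_ ?_
  · rintro A B ⟨M, hM⟩ ⟨N, hN⟩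
    refine ⟨max M N, ?_⟩
    rintro r (hr | hr)
    · exact (hM r hr).trans (le_max_left _ _)
    · exact (hN r hr).trans (le_max_right _ _)
  · intro x hx
    obtain ⟨M, hM⟩ := hU hx
    refine ⟨{r | r ∈ Icc 0 S → l r ≤ M} ∩ uIcc s t,
      inter_mem (mem_nhdsWithin_of_mem_nhds hM) self_mem_nhdsWithin, M,
      fun r hr => hr.1 (hsub hr.2)⟩

lemma le_two_mul_of_boundary (h : SupControlled p l k S) {r a : ℝ} (hr : r ∈ Icc 0 S)
    (ha : a ∈ Icc 0 S) (hra : 2 * k * |a - r| ≤ 1)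
    (hU : ∀ x ∈ uIcc r a, x ≠ a → x ∈ locBdd l S) : l r ≤ 2 * l a := by
  have hsub : uIcc r a ⊆ Icc 0 S := ordConnected_Icc.uIcc_subset hr ha
  refine h.le_two_mul ha hr (by rwa [abs_sub_comm]) ⟨max (2 * l r) (l a), fun x hx => ?_⟩
  rw [uIcc_comm] at hx
  by_cases hxa : x = a
  · rw [hxa]; exact le_max_right _ _
  refine le_trans ?_ (le_max_left _ _)
  have h2 : |x - r| ≤ |a - r| := abs_sub_left_of_mem_uIcc hx
  refine h.le_two_mul hr (hsub hx) ?_ (exists_bound_of_subset_locBdd hr (hsub hx) ?_)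
  · nlinarith [h.k_nonneg]
  · intro y hy
    refine hU y (uIcc_subset_uIcc_left hx hy) ?_
    rintro rfl
    rw [mem_uIcc] at hx hy
    rcases hx with hx | hx <;> rcases hy with hy | hy <;> exact hxa (by linarith [hx.1, hx.2, hy.1, hy.2])

lemma subset_locBdd (h : SupControlled p l k S) : Icc 0 S ⊆ locBdd l S := by
  by_contra hne
  set E : Set ℝ := Icc 0 S ∩ (locBdd l S)ᶜ with hE
  have hEc : IsCompact E := isCompact_Icc.inter_right (isOpen_locBdd l S).isClosed_compl
  obtain ⟨c₀, hc₀, hc₀'⟩ := not_subset.1 hne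
  have : Nonempty E := ⟨⟨c₀, hc₀, hc₀'⟩⟩
  have : CompactSpace E := isCompact_iff_compactSpace.1 hEc
  obtain ⟨n, ⟨c, hcE⟩, hc⟩ := nonempty_interior_of_iUnion_of_closed
    (f := fun n : ℕ => {x : E | ∀ i, p i x ≤ n}) (fun n => by
      simp only [ofPred_forall]
      refine isClosed_iInter fun i => isClosed_le ?_ continuous_const
      exact (h.cont i).comp_continuous continuous_subtype_val (fun x => x.2.1))
    (by
      refine eq_univ_of_forall fun x => mem_iUnion.2 ?_
      obtain ⟨n, hn⟩ := exists_nat_ge (l x)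
      exact ⟨n, fun i => ((h.lub x x.2.1).1 ⟨i, rfl⟩).trans hn⟩)
  rw [mem_interior_iff_mem_nhds, Metric.mem_nhds_iff] at hc
  obtain ⟨δ₀, hδ₀, hball⟩ := hc
  have hle : ∀ x ∈ E, |x - c| < δ₀ → l x ≤ n := by
    intro x hx hxc
    apply (h.lub x hx.1).2
    rintro _ ⟨i, rfl⟩
    exact hball (show (⟨x, hx⟩ : E) ∈ Metric.ball (⟨c, hcE⟩ : E) δ₀ by
      rw [Metric.mem_ball, Subtype.dist_eq, Real.dist_eq]; exact hxc) i
  have hk := h.k_nonneg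
  set δ := min δ₀ (1 / (2 * k + 1)) with hδ
  have hδpos : 0 < δ := lt_min hδ₀ (by positivity)
  have hkδ : 2 * k * δ ≤ 1 := by
    have : δ ≤ 1 / (2 * k + 1) := min_le_right _ _
    rw [le_div_iff₀ (by positivity)] at this
    nlinarith
  apply hcE.2
  refine ⟨2 * n, ?_⟩
  filter_upwards [Metric.ball_mem_nhds c hδpos] with r hrc hr
  rw [Metric.mem_ball, Real.dist_eq] at hrc
  obtain ⟨a, ⟨haE, hau⟩, hmin⟩ := (hEc.inter_right isCompact_uIcc.isClosed).exists_isMinOn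
    ⟨c, hcE, right_mem_uIcc (a := r)⟩ (f := fun x => |x - r|) (by fun_prop)
  have har : |a - r| ≤ |c - r| := abs_sub_left_of_mem_uIcc hau
  have hac : |a - c| ≤ |r - c| := abs_sub_left_of_mem_uIcc (by rwa [uIcc_comm])
  have h1 : l r ≤ 2 * l a := by
    refine h.le_two_mul_of_boundary hr haE.1 ?_ ?_
    · rw [abs_sub_comm c] at har
      nlinarith
    · intro x hx hxa
      by_contra hxU
      have h3 := hmin ⟨⟨ordConnected_Icc.uIcc_subset hr haE.1 hx, hxU⟩,
        uIcc_subset_uIcc_left hau hx⟩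
      simp only [mem_ofPred_eq] at h3
      apply hxa
      rw [mem_uIcc] at hx
      rcases hx with hx | hx
      · rw [abs_of_nonneg (by linarith [hx.1, hx.2]), abs_of_nonneg (by linarith [hx.1])] at h3
        linarith [hx.2]
      · rw [abs_of_nonpos (by linarith [hx.1, hx.2]), abs_of_nonpos (by linarith [hx.2])] at h3
        linarith [hx.1]
  have h2 := hle a haE (hac.trans_lt (hrc.trans_le (min_le_left _ _)))
  linarith

lemma le_mul_exp (h : SupControlled p l k S) (hS : 0 ≤ S) : l S ≤ l 0 * exp (k * S) := by
  have h0 : (0:ℝ) ∈ Icc 0 S := left_mem_Icc.2 hS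
  have hS' : S ∈ Icc 0 S := right_mem_Icc.2 hS
  obtain ⟨M, hM⟩ := exists_bound_of_subset_locBdd (l := l) h0 hS'
    (by rw [uIcc_of_le hS]; exact h.subset_locBdd)
  rw [uIcc_of_le hS] at hM
  have hk := h.k_nonneg
  have hMn : 0 ≤ M := (h.nonneg 0 h0).trans (hM 0 h0)
  have hcont : ContinuousOn l (Icc 0 S) := by
    refine (LipschitzOnWith.of_dist_le_mul (K := (k * M).toNNReal) fun x hx y hy => ?_).continuousOn
    rw [Real.coe_toNNReal _ (by positivity), Real.dist_eq, Real.dist_eq, abs_le']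
    have h1 := h.sup_incr hx hy (fun r hr => hM r (ordConnected_Icc.uIcc_subset hx hy hr))
    have h2 := h.sup_incr hy hx (fun r hr => hM r (ordConnected_Icc.uIcc_subset hy hx hr))
    rw [abs_sub_comm] at h1
    constructor <;> linarith
  have := le_gronwallBound_of_liminf_deriv_right_le (f := l) (f' := fun x => k * l x) (K := k)
    (ε := 0) (δ := l 0) hcont ?_ le_rfl (fun x _ => by simp) S hS'
  · simpa [gronwallBound_ε0] using this
  · intro x hx r hr
    apply Eventually.frequently
    have hxI : x ∈ Icc 0 S := Ico_subset_Icc_self hx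
    obtain ⟨M', hM', hM'r⟩ : ∃ M', l x < M' ∧ k * M' < r := by
      have : ∀ᶠ m in 𝓝[>] (l x), k * m < r :=
        ((continuous_const.mul continuous_id).tendsto (l x)).mono_left nhdsWithin_le_nhds
          |>.eventually (gt_mem_nhds hr)
      obtain ⟨m, hm, hm'⟩ := (this.and self_mem_nhdsWithin).exists
      exact ⟨m, hm', hm⟩
    have hev : ∀ᶠ z in 𝓝[Icc 0 S] x, l z < M' := (hcont x hxI).eventually (gt_mem_nhds hM')
    rw [eventually_nhdsWithin_iff, Metric.eventually_nhds_iff] at hev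
    obtain ⟨ε, hε, hev⟩ := hev
    have hlt : x < min S (x + ε) := lt_min hx.2 (by linarith)
    filter_upwards [Ioo_mem_nhdsGT hlt] with z hz
    have hzS : z < S := hz.2.trans_le (min_le_left _ _)
    have hzε : z < x + ε := hz.2.trans_le (min_le_right _ _)
    have h1 := h.sup_incr hxI ⟨hx.1.trans hz.1.le, hzS.le⟩ (M := M') (fun y hy => by
      rw [uIcc_of_le hz.1.le] at hy
      refine (hev ?_ ⟨hx.1.trans hy.1, hy.2.trans hzS.le⟩).le
      rw [Real.dist_eq, abs_of_nonneg (by linarith [hy.1])]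
      linarith [hy.2])
    have hzx : 0 < z - x := by linarith [hz.1]
    rw [abs_of_pos hzx] at h1
    calc (z - x)⁻¹ * (l z - l x) ≤ (z - x)⁻¹ * (k * M' * (z - x)) := by gcongr
      _ = k * M' := by field_simp
      _ < r := hM'r

end SupControlled

/-- The length of the polygon inscribed in `γ` with vertices at the parameters `k / n`. -/
def polyLen (γ : ℝ → R2) (n : ℕ) : ℝ :=
  ∑ k ∈ Finset.range n, ‖γ ((k + 1 : ℕ) / n) - γ ((k : ℕ) / n)‖

lemma div_mem_Icc {k n : ℕ} (h : k ≤ n) : (k / n : ℝ) ∈ Icc (0:ℝ) 1 :=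
  ⟨by positivity, div_le_one_of_le₀ (by exact_mod_cast h) (by positivity)⟩

lemma div_le_succ_div (k n : ℕ) : (k / n : ℝ) ≤ (k + 1 : ℕ) / n := by
  gcongr; exact Nat.le_succ k

lemma intervalIntegrable_of_subset {E : Type*} [NormedAddCommGroup E] {g : ℝ → E}
    (hg : IntervalIntegrable g volume 0 1) {a b : ℝ} (ha : a ∈ Icc (0:ℝ) 1)
    (hb : b ∈ Icc (0:ℝ) 1) : IntervalIntegrable g volume a b := by
  refine hg.mono_set ?_
  rw [uIcc_of_le zero_le_one]
  exact ordConnected_Icc.uIcc_subset ha hb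

lemma sum_integral_partition {n : ℕ} (hn : n ≠ 0) {f : ℝ → ℝ}
    (hf : IntervalIntegrable f volume 0 1) :
    ∑ k ∈ Finset.range n, ∫ x in ((k : ℕ) / n : ℝ)..((k + 1 : ℕ) / n), f x = ∫ x in (0:ℝ)..1, f x := by
  have := sum_integral_adjacent_intervals (μ := volume) (f := f) (a := fun k : ℕ => (k / n : ℝ)) (n := n)
    (fun k hk => intervalIntegrable_of_subset hf (div_mem_Icc hk.le) (div_mem_Icc hk))
  rw [this]
  simp [hn]

section PolyLen

variable {γ g : ℝ → R2}

lemma IsW11.intervalIntegrable (h : IsW11 γ g) (a b : ℝ) : IntervalIntegrable g volume a b :=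
  (h.2.2.1.integrableOn_isCompact isCompact_uIcc).intervalIntegrable

lemma IsW11.sub_eq_integral (h : IsW11 γ g) (a b : ℝ) : γ b - γ a = ∫ x in a..b, g x := by
  rw [h.2.2.2 a, h.2.2.2 b, add_sub_add_left_eq_sub,
    integral_interval_sub_left (h.intervalIntegrable _ _) (h.intervalIntegrable _ _)]

lemma polyLen_le (h : IsW11 γ g) (n : ℕ) : polyLen γ n ≤ clen g := by
  rcases eq_or_ne n 0 with rfl | hn
  · simp only [polyLen, Finset.range_zero, Finset.sum_empty]
    exact intervalIntegral.integral_nonneg zero_le_one fun _ _ => norm_nonneg _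
  rw [polyLen, clen, ← sum_integral_partition hn (h.intervalIntegrable 0 1).norm]
  refine Finset.sum_le_sum fun k _ => ?_
  rw [h.sub_eq_integral]
  exact intervalIntegral.norm_integral_le_integral_norm (div_le_succ_div k n)

lemma integral_norm_le_of_continuous_approx {c : ℝ → R2} (hc : Continuous c) {a b η : ℝ}
    (hab : a ≤ b) (hg : IntervalIntegrable g volume a b)
    (hosc : ∀ x ∈ Icc a b, ‖c x - c a‖ ≤ η) :
    (∫ x in a..b, ‖g x‖) ≤
      ‖∫ x in a..b, g x‖ + 2 * (∫ x in a..b, ‖g x - c x‖) + 2 * η * (b - a) := by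
  have hci : IntervalIntegrable c volume a b := hc.intervalIntegrable _ _
  have h1 : (∫ x in a..b, ‖g x‖) ≤ ∫ x in a..b, (‖g x - c x‖ + (η + ‖c a‖)) := by
    refine integral_mono_on hab hg.norm ((hg.sub hci).norm.add (by simp)) fun x hx => ?_
    have := hosc x hx
    calc ‖g x‖ = ‖(g x - c x) + ((c x - c a) + c a)‖ := by congr 1; abel
      _ ≤ _ := (norm_add_le _ _).trans (by gcongr; exact (norm_add_le _ _).trans (by gcongr))
  rw [integral_add (hg.sub hci).norm (by simp), intervalIntegral.integral_const, smul_eq_mul] at h1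
  have h2 : (b - a) * ‖c a‖ ≤ ‖∫ x in a..b, g x‖ + ((∫ x in a..b, ‖g x - c x‖) + η * (b - a)) := by
    have e : (∫ x in a..b, g x) - (∫ x in a..b, (g x - c a)) = (b - a) • c a := by
      rw [← integral_sub hg (hg.sub (by simp))]
      simp
    have e2 : ‖∫ x in a..b, (g x - c a)‖ ≤ ∫ x in a..b, (‖g x - c x‖ + η) := by
      refine (intervalIntegral.norm_integral_le_integral_norm hab).trans ?_
      refine integral_mono_on hab (hg.sub (by simp)).norm ((hg.sub hci).norm.add (by simp))
        fun x hx => ?_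
      calc ‖g x - c a‖ = ‖(g x - c x) + (c x - c a)‖ := by congr 1; abel
        _ ≤ _ := (norm_add_le _ _).trans (by gcongr; exact hosc x hx)
    rw [integral_add (hg.sub hci).norm (by simp), intervalIntegral.integral_const, smul_eq_mul] at e2
    have e3 := norm_sub_le (∫ x in a..b, g x) (∫ x in a..b, (g x - c a))
    rw [e, norm_smul, Real.norm_of_nonneg (by linarith)] at e3
    linarith
  linarith

lemma exists_clen_le_polyLen_add (h : IsW11 γ g) {ε : ℝ} (hε : 0 < ε) :
    ∃ n, clen g ≤ polyLen γ n + ε := by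
  have hg := h.intervalIntegrable 0 1
  obtain ⟨c, -, hcε, hc, hci⟩ :=
    (hg.1 : IntegrableOn g (Ioc 0 1)).integrable.exists_hasCompactSupport_integral_sub_le
      (show 0 < ε / 4 by positivity)
  rw [← integral_of_le zero_le_one] at hcε
  have huc := isCompact_Icc.uniformContinuousOn_of_continuous
    (hc.continuousOn (s := Icc (0:ℝ) 1))
  rw [Metric.uniformContinuousOn_iff_le] at huc
  obtain ⟨δ, hδ, hosc⟩ := huc (ε / 4) (by positivity)
  obtain ⟨m, hm⟩ := exists_nat_one_div_lt hδ
  set n := m + 1 with hn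
  refine ⟨n, ?_⟩
  have hn0 : n ≠ 0 := Nat.succ_ne_zero m
  have hn0' : (n : ℝ) ≠ 0 := by exact_mod_cast hn0
  have hci' : IntervalIntegrable c volume 0 1 := hc.intervalIntegrable _ _
  rw [clen, ← sum_integral_partition hn0 hg.norm]
  have key : ∀ k ∈ Finset.range n, (∫ x in ((k : ℕ) / n : ℝ)..((k + 1 : ℕ) / n), ‖g x‖) ≤
      ‖γ ((k + 1 : ℕ) / n) - γ ((k : ℕ) / n)‖ +
        2 * (∫ x in ((k : ℕ) / n : ℝ)..((k + 1 : ℕ) / n), ‖g x - c x‖) + 2 * (ε / 4) * (1 / n) := by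
    intro k hk
    have hk' : k < n := Finset.mem_range.1 hk
    have hlen : ((k + 1 : ℕ) / n : ℝ) - (k : ℕ) / n = 1 / n := by push_cast; ring
    have := integral_norm_le_of_continuous_approx hc (η := ε / 4) (div_le_succ_div k n)
      (h.intervalIntegrable _ _) (fun x hx => by
        have := hosc x ⟨(div_mem_Icc hk'.le).1.trans hx.1, hx.2.trans (div_mem_Icc hk').2⟩
          _ (div_mem_Icc hk'.le) (by
            rw [Real.dist_eq, abs_of_nonneg (by linarith [hx.1])]
            have : (1:ℝ) / n < δ := by rw [hn]; push_cast; exact hm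
            linarith [hx.2])
        rwa [dist_eq_norm] at this)
    rwa [h.sub_eq_integral, ← hlen]
  refine (Finset.sum_le_sum key).trans ?_
  rw [Finset.sum_add_distrib, Finset.sum_add_distrib, ← Finset.mul_sum,
    sum_integral_partition hn0 (hg.sub hci').norm, Finset.sum_const, Finset.card_range, nsmul_eq_mul]
  have : (n : ℝ) * (2 * (ε / 4) * (1 / n)) = ε / 2 := by field_simp; ring
  rw [this, polyLen]
  linarith

lemma isLUB_polyLen (h : IsW11 γ g) : IsLUB (range fun n => polyLen γ n) (clen g) := by
  refine ⟨?_, fun b hb => le_of_forall_pos_le_add fun ε hε => ?_⟩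
  · rintro _ ⟨n, rfl⟩
    exact polyLen_le h n
  · obtain ⟨n, hn⟩ := exists_clen_le_polyLen_add h hε
    have : polyLen γ n ≤ b := hb ⟨n, rfl⟩
    linarith

end PolyLen




section GreenODE

/-- The solution of `U' = a U + (α - β) Y` on `[0,1]` built from the exponentially weighted
primitives of `Y`. -/
def expPrim (a α β : ℝ) (Y : ℝ → R2) (x : ℝ) : R2 :=
  exp (a * x) • (α • (∫ y in (0:ℝ)..x, exp (-(a * y)) • Y y) +
    β • ∫ y in x..1, exp (-(a * y)) • Y y)

lemma hasDerivAt_expPrim (a α β : ℝ) {Y : ℝ → R2} (hY : Continuous Y) (x : ℝ) :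
    HasDerivAt (expPrim a α β Y) (a • expPrim a α β Y x + (α - β) • Y x) x := by
  have hc : Continuous fun y => exp (-(a * y)) • Y y := by fun_prop
  have h1 : HasDerivAt (fun x => ∫ y in (0:ℝ)..x, exp (-(a * y)) • Y y) (exp (-(a * x)) • Y x) x :=
    integral_hasDerivAt_right (hc.intervalIntegrable _ _) (hc.stronglyMeasurableAtFilter _ _)
      hc.continuousAt
  have h2 : HasDerivAt (fun x => ∫ y in x..1, exp (-(a * y)) • Y y) (-(exp (-(a * x)) • Y x)) x :=
    integral_hasDerivAt_left (hc.intervalIntegrable _ _) (hc.stronglyMeasurableAtFilter _ _)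
      hc.continuousAt
  have h3 : HasDerivAt (fun x => exp (a * x)) (exp (a * x) * a) x := by
    simpa using ((hasDerivAt_id x).const_mul a).exp
  have h4 := h3.smul ((h1.const_smul α).add (h2.const_smul β))
  refine h4.congr_deriv ?_
  have he : exp (a * x) * exp (-(a * x)) = 1 := by rw [← Real.exp_add]; simp
  have : exp (a * x) • (α • exp (-(a * x)) • Y x + β • -(exp (-(a * x)) • Y x)) =
      (exp (a * x) * exp (-(a * x))) • ((α - β) • Y x) := by module
  simp only [Pi.add_apply, Pi.smul_apply]
  rw [this, he, one_smul, expPrim]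
  module

lemma neg_Gker_eq {lam : ℝ} (hlam : 0 < lam) {d : ℝ} (hd : 0 ≤ d) :
    -Gker lam d = (4 * lam * sinh (1 / (2 * lam)))⁻¹ *
      (exp (-(1 / (2 * lam))) * exp (d / lam) + exp (1 / (2 * lam)) * exp (-(d / lam))) := by
  have : 0 < sinh (1 / (2 * lam)) := Real.sinh_pos_iff.2 (by positivity)
  rw [Gker, neg_neg, abs_of_nonneg hd, Real.cosh_eq, ← Real.exp_add, ← Real.exp_add]
  have e1 : (d - 1 / 2) / lam = -(1 / (2 * lam)) + d / lam := by field_simp; ring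
  have e2 : -(-(1 / (2 * lam)) + d / lam) = 1 / (2 * lam) + -(d / lam) := by ring
  rw [e1, e2]
  field_simp
  ring

/-- The periodic Green operator: `Z - λ² Z'' = Y` on the unit circle, where `Z` is minus the
convolution of `Y` with `G^λ`. -/
lemma exists_green_solution {lam : ℝ} (hlam : 0 < lam) {Y : ℝ → R2} (hY : Continuous Y) :
    ∃ Z V : ℝ → R2, (∀ x, HasDerivAt Z (V x) x) ∧
      (∀ x, HasDerivAt V ((1 / lam ^ 2) • (Z x - Y x)) x) ∧ Z 0 = Z 1 ∧ V 0 = V 1 ∧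
      ∀ x ∈ Icc (0:ℝ) 1, (∫ y in (0:ℝ)..1, Gker lam (y - x) • Y y) = -Z x := by
  have hs : 0 < sinh (1 / (2 * lam)) := Real.sinh_pos_iff.2 (by positivity)
  set q := exp (-(1 / (2 * lam))) with hq
  set q' := exp (1 / (2 * lam)) with hq'
  have hqq : q' - q = 2 * sinh (1 / (2 * lam)) := by rw [Real.sinh_eq]; ring
  have hqq1 : q * q' = 1 := by rw [hq, hq', ← Real.exp_add]; simp
  set c := (4 * lam * sinh (1 / (2 * lam)))⁻¹ with hc
  set U := expPrim lam⁻¹ q q' Y with hU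
  set W := expPrim (-lam⁻¹) q' q Y with hW
  have hU' := hasDerivAt_expPrim lam⁻¹ q q' hY
  have hW' := hasDerivAt_expPrim (-lam⁻¹) q' q hY
  have hlam' : exp lam⁻¹ = q' * q' := by
    rw [hq', ← Real.exp_add]; congr 1; field_simp; norm_num
  have hlam'' : exp (-lam⁻¹) = q * q := by
    rw [hq, ← Real.exp_add]; congr 1; field_simp; norm_num
  have hU01 : U 0 = U 1 := by
    simp only [hU, expPrim, mul_zero, Real.exp_zero, integral_same, mul_one, hlam', smul_zero,
      zero_add, add_zero, smul_smul]
    congr 1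
    linear_combination (-q') * hqq1
  have hW01 : W 0 = W 1 := by
    simp only [hW, expPrim, mul_zero, Real.exp_zero, integral_same, mul_one, hlam'', smul_zero,
      zero_add, add_zero, smul_smul]
    congr 1
    linear_combination (-q) * hqq1
  refine ⟨fun x => c • (U x + W x), fun x => (c * lam⁻¹) • (U x - W x), fun x => ?_, fun x => ?_,
    by simp only [hU01, hW01], by simp only [hU01, hW01], fun x hx => ?_⟩
  · refine (((hU' x).add (hW' x)).const_smul c).congr_deriv ?_
    module
  · refine (((hU' x).sub (hW' x)).const_smul (c * lam⁻¹)).congr_deriv ?_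
    have e : (c * lam⁻¹) * (2 * (q' - q)) = 1 / lam ^ 2 := by
      rw [hqq, hc]; field_simp; norm_num
    have e' : 1 / lam ^ 2 = lam⁻¹ * lam⁻¹ := by field_simp
    have e3 : (1 / lam ^ 2) • (c • (U x + W x) - Y x) = (lam⁻¹ * lam⁻¹) • c • (U x + W x) -
        ((c * lam⁻¹) * (2 * (q' - q))) • Y x := by
      rw [e, ← e', smul_sub]
    rw [e3, ← hU, ← hW]
    module
  · have hcont : Continuous fun y => Gker lam (y - x) • Y y := by unfold Gker; fun_prop
    have hi1 : ∀ a b : ℝ, IntervalIntegrable (fun y => exp (-(lam⁻¹ * y)) • Y y) volume a b :=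
      fun a b => Continuous.intervalIntegrable (by fun_prop) _ _
    have hi2 : ∀ a b : ℝ, IntervalIntegrable (fun y => exp (-(-lam⁻¹ * y)) • Y y) volume a b :=
      fun a b => Continuous.intervalIntegrable (by fun_prop) _ _
    rw [← integral_add_adjacent_intervals (hcont.intervalIntegrable 0 x)
      (hcont.intervalIntegrable x 1)]
    have e1 : (∫ y in (0:ℝ)..x, Gker lam (y - x) • Y y) =
        ∫ y in (0:ℝ)..x, ((-(c * (q * exp (lam⁻¹ * x)))) • exp (-(lam⁻¹ * y)) • Y y +
          (-(c * (q' * exp (-lam⁻¹ * x)))) • exp (-(-lam⁻¹ * y)) • Y y) := by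
      refine integral_congr fun y hy => ?_
      rw [uIcc_of_le hx.1] at hy
      have h := neg_Gker_eq hlam (sub_nonneg.2 hy.2)
      have h' : Gker lam (y - x) = Gker lam (x - y) := by rw [Gker, Gker, abs_sub_comm]
      have e3 : exp ((x - y) / lam) = exp (lam⁻¹ * x) * exp (-(lam⁻¹ * y)) := by
        rw [← Real.exp_add]; congr 1; ring
      have e4 : exp (-((x - y) / lam)) = exp (-lam⁻¹ * x) * exp (-(-lam⁻¹ * y)) := by
        rw [← Real.exp_add]; congr 1; ring
      rw [h', neg_eq_iff_eq_neg.1 h, e3, e4]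
      module
    have e2 : (∫ y in x..1, Gker lam (y - x) • Y y) =
        ∫ y in x..1, ((-(c * (q' * exp (lam⁻¹ * x)))) • exp (-(lam⁻¹ * y)) • Y y +
          (-(c * (q * exp (-lam⁻¹ * x)))) • exp (-(-lam⁻¹ * y)) • Y y) := by
      refine integral_congr fun y hy => ?_
      rw [uIcc_of_le hx.2] at hy
      have h := neg_Gker_eq hlam (sub_nonneg.2 hy.1)
      have e3 : exp (-((y - x) / lam)) = exp (lam⁻¹ * x) * exp (-(lam⁻¹ * y)) := by
        rw [← Real.exp_add]; congr 1; ring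
      have e4 : exp ((y - x) / lam) = exp (-lam⁻¹ * x) * exp (-(-lam⁻¹ * y)) := by
        rw [← Real.exp_add]; congr 1; ring
      rw [neg_eq_iff_eq_neg.1 h, e3, e4]
      module
    have e5 : ∀ a b m₁ m₂ : ℝ, (∫ y in a..b, (m₁ • exp (-(lam⁻¹ * y)) • Y y +
        m₂ • exp (-(-lam⁻¹ * y)) • Y y)) = m₁ • (∫ y in a..b, exp (-(lam⁻¹ * y)) • Y y) +
        m₂ • ∫ y in a..b, exp (-(-lam⁻¹ * y)) • Y y := fun a b m₁ m₂ => by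
      rw [← intervalIntegral.integral_smul, ← intervalIntegral.integral_smul]
      exact integral_add ((hi1 a b).smul m₁) ((hi2 a b).smul m₂)
    rw [e1, e2, e5, e5]
    simp only [hU, hW, expPrim]
    module

end GreenODE



section Energy

lemma sq_integral_le {f : ℝ → ℝ} (hf : Continuous f) :
    (∫ x in (0:ℝ)..1, f x) ^ 2 ≤ ∫ x in (0:ℝ)..1, f x ^ 2 := by
  set m := ∫ x in (0:ℝ)..1, f x with hm
  have h1 : 0 ≤ ∫ x in (0:ℝ)..1, (f x - m) ^ 2 :=
    intervalIntegral.integral_nonneg zero_le_one fun _ _ => sq_nonneg _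
  have h2 : (∫ x in (0:ℝ)..1, (f x - m) ^ 2) =
      (∫ x in (0:ℝ)..1, f x ^ 2) - (∫ x in (0:ℝ)..1, 2 * m * f x) + ∫ x in (0:ℝ)..1, m ^ 2 := by
    rw [← intervalIntegral.integral_sub, ← intervalIntegral.integral_add]
    · congr 1; ext x; ring
    all_goals exact Continuous.intervalIntegrable (by fun_prop) _ _
  rw [intervalIntegral.integral_const_mul, ← hm, intervalIntegral.integral_const] at h2
  simp only [sub_zero, one_smul] at h2
  nlinarith

lemma neg_integral_inner_le {K : NNReal} {Y V D : ℝ → R2} (hY : LipschitzWith K Y)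
    (hY01 : Y 0 = Y 1) (hV : ∀ x, HasDerivAt V (D x) x) (hD : Continuous D) (hV01 : V 0 = V 1) :
    -(∫ x in (0:ℝ)..1, ⟪Y x, D x⟫) ≤ K * ∫ x in (0:ℝ)..1, ‖V x‖ := by
  have hVc : Continuous V := continuous_iff_continuousAt.2 fun x => (hV x).continuousAt
  have hYc := hY.continuous
  set Φ : ℝ → ℝ := fun x => ⟪Y x, V x⟫ with hΦ
  have hac : AbsolutelyContinuousOnInterval Φ 0 1 := by
    have hYi : ∀ i, AbsolutelyContinuousOnInterval (fun x => Y x i) 0 1 := fun i => by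
      refine LipschitzOnWith.absolutelyContinuousOnInterval (K := K)
        (LipschitzWith.lipschitzOnWith (LipschitzWith.of_dist_le_mul fun x y => ?_))
      refine le_trans ?_ (hY.dist_le_mul x y)
      rw [Real.dist_eq, dist_eq_norm]
      exact PiLp.norm_apply_le (Y x - Y y) i
    have hVi : ∀ i, AbsolutelyContinuousOnInterval (fun x => V x i) 0 1 := fun i => by
      have hd : ∀ x, HasDerivAt (fun x => V x i) (D x i) x := fun x =>
        (EuclideanSpace.proj (𝕜 := ℝ) i).hasFDerivAt.comp_hasDerivAt x (hV x)
      refine ContDiffOn.absolutelyContinuousOnInterval (ContDiff.contDiffOn ?_)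
      refine contDiff_one_iff_deriv.2 ⟨fun x => (hd x).differentiableAt, ?_⟩
      rw [show deriv (fun x => V x i) = fun x => D x i from funext fun x => (hd x).deriv]
      fun_prop
    have : Φ = (fun x => Y x 0) * (fun x => V x 0) + (fun x => Y x 1) * (fun x => V x 1) := by
      ext x
      simp [hΦ, PiLp.inner_apply, Fin.sum_univ_two, mul_comm]
    rw [this]
    exact ((hYi 0).mul (hVi 0)).add ((hYi 1).mul (hVi 1))
  have h0 : (∫ x in (0:ℝ)..1, deriv Φ x) = 0 := by
    rw [hac.integral_deriv_eq_sub, hΦ]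
    simp [hY01, hV01]
  have hle : (∫ x in (0:ℝ)..1, deriv Φ x) ≤ ∫ x in (0:ℝ)..1, (⟪Y x, D x⟫ + K * ‖V x‖) := by
    refine integral_mono_ae zero_le_one hac.intervalIntegrable_deriv
      (Continuous.intervalIntegrable (by fun_prop) _ _) ?_
    filter_upwards [hY.ae_differentiableAt_real] with x hx
    rw [hΦ, (hx.hasDerivAt.inner ℝ (hV x)).deriv]
    gcongr
    exact (real_inner_le_norm _ _).trans (by gcongr; exact norm_deriv_le_of_lipschitz hY)
  rw [intervalIntegral.integral_add, intervalIntegral.integral_const_mul, h0] at hle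
  · linarith
  all_goals exact Continuous.intervalIntegrable (by fun_prop) _ _

lemma two_mul_norm_sub_le {V D : ℝ → R2} (hV : ∀ x, HasDerivAt V (D x) x) (hD : Continuous D)
    (hV01 : V 0 = V 1) {x y : ℝ} (hx : x ∈ Icc (0:ℝ) 1) (hy : y ∈ Icc (0:ℝ) 1) :
    2 * ‖V x - V y‖ ≤ ∫ z in (0:ℝ)..1, ‖D z‖ := by
  wlog hxy : x ≤ y generalizing x y
  · rw [norm_sub_rev]; exact this hy hx (le_of_not_ge hxy)
  have hi : ∀ a b, IntervalIntegrable D volume a b := fun a b => hD.intervalIntegrable a b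
  have hftc : ∀ a b : ℝ, a ≤ b → ‖V b - V a‖ ≤ ∫ z in a..b, ‖D z‖ := fun a b hab => by
    rw [← integral_eq_sub_of_hasDerivAt (fun z _ => hV z) (hi a b)]
    exact intervalIntegral.norm_integral_le_integral_norm hab
  have h1 : ‖V x - V y‖ ≤ (∫ z in (0:ℝ)..x, ‖D z‖) + ∫ z in y..1, ‖D z‖ :=
    calc ‖V x - V y‖ = ‖(V x - V 0) + (V 1 - V y)‖ := by rw [hV01]; congr 1; abel
      _ ≤ _ := (norm_add_le _ _).trans (add_le_add (hftc _ _ hx.1) (hftc _ _ hy.2))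
  have h2 := hftc x y hxy
  rw [norm_sub_rev] at h2
  have h3 := integral_add_adjacent_intervals (hi 0 x).norm (hi x y).norm
  have h4 := integral_add_adjacent_intervals (hi 0 y).norm (hi y 1).norm
  linarith

/-- The length of the smoothed curve `Z`, where `Z - λ² Z'' = Y`, is at most `1 / (1 + 4 λ²)` times
the Lipschitz constant of `Y`. -/
lemma integral_norm_deriv_green_le {lam : ℝ} (hlam : 0 < lam) {K : NNReal} {Y Z V : ℝ → R2}
    (hY : LipschitzWith K Y) (hY01 : Y 0 = Y 1) (hZ : ∀ x, HasDerivAt Z (V x) x)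
    (hV : ∀ x, HasDerivAt V ((1 / lam ^ 2) • (Z x - Y x)) x) (hZ01 : Z 0 = Z 1)
    (hV01 : V 0 = V 1) :
    (1 + 4 * lam ^ 2) * (∫ x in (0:ℝ)..1, ‖V x‖) ≤ K := by
  have hVc : Continuous V := continuous_iff_continuousAt.2 fun x => (hV x).continuousAt
  have hZc : Continuous Z := continuous_iff_continuousAt.2 fun x => (hZ x).continuousAt
  have hYc := hY.continuous
  set D : ℝ → R2 := fun x => (1 / lam ^ 2) • (Z x - Y x) with hDdef
  have hD : Continuous D := by fun_prop
  have hYD : ∀ x, Y x = Z x - lam ^ 2 • D x := fun x => by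
    have : lam ^ 2 * (1 / lam ^ 2) = 1 := by field_simp
    rw [hDdef, smul_smul, this, one_smul]; abel
  set a := ∫ x in (0:ℝ)..1, ‖V x‖
  set b := ∫ x in (0:ℝ)..1, ‖V x‖ ^ 2
  set d₁ := ∫ x in (0:ℝ)..1, ‖D x‖
  set d := ∫ x in (0:ℝ)..1, ‖D x‖ ^ 2
  have ha : 0 ≤ a := intervalIntegral.integral_nonneg zero_le_one fun _ _ => norm_nonneg _
  have hab : a ^ 2 ≤ b := sq_integral_le (by fun_prop)
  have hdd : d₁ ^ 2 ≤ d := sq_integral_le (by fun_prop)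
  have hVint : (∫ x in (0:ℝ)..1, V x) = 0 := by
    rw [integral_eq_sub_of_hasDerivAt (fun z _ => hZ z) (hVc.intervalIntegrable 0 1), hZ01, sub_self]
  have hsup : ∀ x ∈ Icc (0:ℝ) 1, ‖V x‖ ≤ d₁ / 2 := fun x hx => by
    have e : V x = ∫ y in (0:ℝ)..1, (V x - V y) := by
      rw [intervalIntegral.integral_sub (by simp) (hVc.intervalIntegrable 0 1), hVint]
      simp
    rw [e]
    have := norm_integral_le_of_norm_le_const (a := (0:ℝ)) (b := 1) (C := d₁ / 2)
      (f := fun y => V x - V y) (fun y hy => by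
        rw [uIoc_of_le zero_le_one] at hy
        have := two_mul_norm_sub_le hV hD hV01 hx (Ioc_subset_Icc_self hy)
        linarith)
    simpa using this
  have hbd : b ≤ (d₁ / 2) ^ 2 := by
    have : b ≤ ∫ x in (0:ℝ)..1, (d₁ / 2) ^ 2 :=
      integral_mono_on zero_le_one (Continuous.intervalIntegrable (by fun_prop) _ _) (by simp)
        fun x hx => pow_le_pow_left₀ (norm_nonneg _) (hsup x hx) 2
    simpa using this
  have hp : -(∫ x in (0:ℝ)..1, ⟪Y x, D x⟫) = b + lam ^ 2 * d := by
    have h1 : (∫ x in (0:ℝ)..1, (⟪Z x, D x⟫ + ‖V x‖ ^ 2)) = 0 := by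
      have := integral_eq_sub_of_hasDerivAt (a := 0) (b := 1) (fun z _ => (hZ z).inner ℝ (hV z))
        (Continuous.intervalIntegrable (by fun_prop) _ _)
      simpa [hZ01, hV01, hDdef] using this
    have h2 : (∫ x in (0:ℝ)..1, ⟪Y x, D x⟫) =
        ∫ x in (0:ℝ)..1, ((⟪Z x, D x⟫ + ‖V x‖ ^ 2) - (‖V x‖ ^ 2 + lam ^ 2 * ‖D x‖ ^ 2)) := by
      congr 1; ext x
      rw [hYD, inner_sub_left, inner_smul_left, real_inner_self_eq_norm_sq]
      simp only [conj_trivial]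
      ring
    rw [h2, intervalIntegral.integral_sub, h1, intervalIntegral.integral_add, intervalIntegral.integral_const_mul]
    · ring
    all_goals exact Continuous.intervalIntegrable (by fun_prop) _ _
  have hle := neg_integral_inner_le hY hY01 hV hD hV01
  rw [hp] at hle
  by_contra! hlt
  have h4 : (1 + 4 * lam ^ 2) * a ^ 2 ≤ K * a := by nlinarith [sq_nonneg lam]
  rcases ha.eq_or_lt with h | h
  · rw [← h, mul_zero] at hlt
    exact absurd K.2 (not_le.2 hlt)
  · nlinarith

end Energy

section ArcLength

variable {γ g : ℝ → R2}

lemma IsW11.carc_sub (h : IsW11 γ g) (u v : ℝ) :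
    carc g v - carc g u = (clen g)⁻¹ * ∫ x in u..v, ‖g x‖ := by
  rw [carc, carc, ← mul_sub, integral_interval_sub_left (h.intervalIntegrable _ _).norm
    (h.intervalIntegrable _ _).norm]

lemma IsW11.continuous_carc (h : IsW11 γ g) : Continuous (carc g) :=
  continuous_const.mul (continuous_primitive (fun a b => (h.intervalIntegrable a b).norm) 0)

lemma carc_zero (g : ℝ → R2) : carc g 0 = 0 := by simp [carc]

lemma carc_one {g : ℝ → R2} (hL : clen g ≠ 0) : carc g 1 = 1 := inv_mul_cancel₀ hL

lemma IsW11.monotone_carc (h : IsW11 γ g) (hL : 0 < clen g) : Monotone (carc g) := fun u v huv => by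
  rw [← sub_nonneg, h.carc_sub]
  exact mul_nonneg (inv_nonneg.2 hL.le)
    (intervalIntegral.integral_nonneg huv fun _ _ => norm_nonneg _)

lemma IsW11.norm_sub_le_carc (h : IsW11 γ g) (hL : 0 < clen g) (u v : ℝ) :
    ‖γ v - γ u‖ ≤ clen g * |carc g v - carc g u| := by
  rw [h.sub_eq_integral, h.carc_sub, abs_mul, abs_of_pos (inv_pos.2 hL), mul_inv_cancel_left₀ hL.ne']
  exact norm_integral_le_abs_integral_norm

/-- The arc length reparametrisation of `γ`, extended by constants outside `[0,1]`. -/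
lemma IsW11.exists_arcLength_param (h : IsW11 γ g) (hL : 0 < clen g) :
    ∃ Y : ℝ → R2, LipschitzWith (clen g).toNNReal Y ∧ Y 0 = Y 1 ∧
      ∀ u ∈ Icc (0:ℝ) 1, Y (carc g u) = γ u := by
  have hsurj : ∀ x ∈ Icc (0:ℝ) 1, ∃ u ∈ Icc (0:ℝ) 1, carc g u = x := fun x hx => by
    have := intermediate_value_Icc zero_le_one h.continuous_carc.continuousOn
    rw [carc_zero, carc_one hL.ne'] at this
    exact this hx
  choose! s hs hcs using hsurj
  have hproj : ∀ x : ℝ, (projIcc (0:ℝ) 1 zero_le_one x : ℝ) ∈ Icc (0:ℝ) 1 := fun x => Subtype.prop _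
  set Y : ℝ → R2 := fun x => γ (s (projIcc (0:ℝ) 1 zero_le_one x)) with hYdef
  have hY : ∀ u ∈ Icc (0:ℝ) 1, Y (carc g u) = γ u := fun u hu => by
    have hm := h.monotone_carc hL
    have hcu : carc g u ∈ Icc (0:ℝ) 1 :=
      ⟨by rw [← carc_zero g]; exact hm hu.1, by rw [← carc_one hL.ne']; exact hm hu.2⟩
    rw [← sub_eq_zero, ← norm_le_zero_iff]
    refine (h.norm_sub_le_carc hL _ _).trans ?_
    rw [hcs _ (hproj _), projIcc_of_mem _ hcu]
    simp
  refine ⟨Y, LipschitzWith.of_dist_le_mul fun x y => ?_, ?_, hY⟩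
  · rw [Real.coe_toNNReal _ hL.le, dist_eq_norm]
    refine (h.norm_sub_le_carc hL _ _).trans ?_
    rw [hcs _ (hproj _), hcs _ (hproj _)]
    gcongr
    have := (LipschitzWith.projIcc (zero_le_one : (0:ℝ) ≤ 1)).dist_le_mul x y
    simpa [Subtype.dist_eq, Real.dist_eq] using this
  · have h0 := hY 0 (by simp)
    have h1 := hY 1 (by simp)
    rw [carc_zero] at h0
    rw [carc_one hL.ne'] at h1
    rw [h0, h1]
    simpa using (h.1 0).symm

lemma IsW11.map_carc (h : IsW11 γ g) (hL : 0 < clen g) :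
    Measure.map (carc g) ((volume.restrict (Ioc (0:ℝ) 1)).withDensity
      fun v => ENNReal.ofReal (‖g v‖ / clen g)) = volume.restrict (Ioc (0:ℝ) 1) := by
  have hc := h.continuous_carc
  have hm := h.monotone_carc hL
  have hint : ∀ u, IntegrableOn (fun v => ‖g v‖ / clen g) (Ioc 0 u) := fun u =>
    ((h.intervalIntegrable 0 u).norm.div_const _).1
  symm
  refine Measure.ext_of_Iic _ _ fun a => ?_
  rw [Measure.map_apply hc.measurable measurableSet_Iic,
    withDensity_apply _ (hc.measurable measurableSet_Iic),
    Measure.restrict_restrict (hc.measurable measurableSet_Iic),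
    Measure.restrict_apply measurableSet_Iic]
  rcases lt_or_ge a 0 with ha | ha
  · have e1 : Iic a ∩ Ioc (0:ℝ) 1 = ∅ := by
      ext x; simp only [mem_inter_iff, mem_Iic, mem_Ioc, mem_empty_iff_false, iff_false]
      rintro ⟨h1, h2, -⟩; linarith
    have e2 : carc g ⁻¹' Iic a ∩ Ioc (0:ℝ) 1 = ∅ := by
      ext x; simp only [mem_inter_iff, mem_preimage, mem_Iic, mem_Ioc, mem_empty_iff_false, iff_false]
      rintro ⟨h1, h2, -⟩
      have := hm h2.le
      rw [carc_zero] at this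
      linarith
    rw [e1, e2]; simp
  · obtain ⟨u, ⟨hu, hua⟩, hmax⟩ :=
      (isCompact_Icc.inter_right (isClosed_Iic.preimage hc)).exists_isGreatest
        (s := Icc (0:ℝ) 1 ∩ carc g ⁻¹' Iic a) ⟨0, by simp, by simpa [carc_zero] using ha⟩
    have hua' : carc g u = min a 1 := by
      have h1 : carc g u ≤ 1 := by rw [← carc_one hL.ne']; exact hm hu.2
      refine le_antisymm (le_min hua h1) ?_
      by_contra! hlt
      have := intermediate_value_Icc hu.2 hc.continuousOn
      rw [carc_one hL.ne'] at this
      obtain ⟨w, hw, hwa⟩ := this ⟨hlt.le, min_le_right _ _⟩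
      have : w ≤ u := hmax ⟨⟨hu.1.trans hw.1, hw.2⟩, by
        rw [mem_preimage, hwa]; exact min_le_left a 1⟩
      rw [le_antisymm this hw.1] at hwa
      exact hlt.ne hwa
    have e1 : Iic a ∩ Ioc (0:ℝ) 1 = Ioc 0 (min a 1) := by
      ext x; simp only [mem_inter_iff, mem_Iic, mem_Ioc, le_min_iff]; tauto
    have e2 : carc g ⁻¹' Iic a ∩ Ioc (0:ℝ) 1 = Ioc 0 u := by
      ext x
      simp only [mem_inter_iff, mem_preimage, mem_Iic, mem_Ioc]
      constructor
      · rintro ⟨h1, h2, h3⟩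
        exact ⟨h2, hmax ⟨⟨h2.le, h3⟩, h1⟩⟩
      · rintro ⟨h1, h2⟩
        exact ⟨(hm h2).trans hua, h1, h2.trans hu.2⟩
    rw [e1, e2, ← ofReal_integral_eq_lintegral_ofReal (hint u)
      (ae_of_all _ fun v => by positivity), Real.volume_Ioc, sub_zero,
      ← integral_of_le hu.1, intervalIntegral.integral_div, ← hua', carc]
    congr 1
    ring

lemma IsW11.integral_comp_carc (h : IsW11 γ g) (hL : 0 < clen g) {f : ℝ → R2} (hf : Continuous f) :
    (∫ v in (0:ℝ)..1, (‖g v‖ / clen g) • f (carc g v)) = ∫ x in (0:ℝ)..1, f x := by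
  have hmeas : AEMeasurable (fun v => ENNReal.ofReal (‖g v‖ / clen g))
      (volume.restrict (Ioc (0:ℝ) 1)) :=
    ((h.intervalIntegrable 0 1).norm.div_const _).1.aemeasurable.ennreal_ofReal
  rw [integral_of_le zero_le_one, integral_of_le zero_le_one, ← h.map_carc hL,
    integral_map h.continuous_carc.aemeasurable hf.aestronglyMeasurable,
    integral_withDensity_eq_integral_toReal_smul₀ hmeas (ae_of_all _ fun _ => ENNReal.ofReal_lt_top),
    h.map_carc hL]
  refine MeasureTheory.integral_congr_ae (ae_of_all _ fun v => ?_)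
  simp only
  rw [ENNReal.toReal_ofReal (by positivity)]

end ArcLength

section FlowEstimate

lemma sum_norm_sub_sum_norm_le {E ι : Type*} [NormedAddCommGroup E] [InnerProductSpace ℝ E]
    {I : Finset ι} {f f' : ι → ℝ → E} {S : Set ℝ} {C : ℝ} (hS : Convex ℝ S)
    (hf : ∀ i ∈ I, ∀ r ∈ S, HasDerivWithinAt (f i) (f' i r) S r)
    (hC : ∀ r ∈ S, ∑ i ∈ I, ‖f' i r‖ ≤ C) {s t : ℝ} (hs : s ∈ S) (ht : t ∈ S) :
    ∑ i ∈ I, ‖f i t‖ - ∑ i ∈ I, ‖f i s‖ ≤ C * |t - s| := by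
  set e : ι → E := fun i => ‖f i t‖⁻¹ • f i t with he
  have he1 : ∀ i, ‖e i‖ ≤ 1 := fun i => by
    rw [he, norm_smul, norm_inv, norm_norm]
    exact inv_mul_le_one
  have hle : ∀ i v, |⟪e i, v⟫| ≤ ‖v‖ := fun i v =>
    (abs_real_inner_le_norm _ _).trans (mul_le_of_le_one_left (norm_nonneg _) (he1 i))
  have het : ∀ i, ⟪e i, f i t⟫ = ‖f i t‖ := fun i => by
    rw [he, real_inner_smul_left, real_inner_self_eq_norm_sq]
    rcases eq_or_ne ‖f i t‖ 0 with h | h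
    · simp [h]
    · field_simp
  have hderiv : ∀ r ∈ S, HasDerivWithinAt (fun r => ∑ i ∈ I, ⟪e i, f i r⟫)
      (∑ i ∈ I, ⟪e i, f' i r⟫) S r := fun r hr =>
    HasDerivWithinAt.fun_sum fun i hi => by
      simpa using (hasDerivWithinAt_const r S (e i)).inner ℝ (hf i hi r hr)
  have hbound : ∀ r ∈ S, ‖∑ i ∈ I, ⟪e i, f' i r⟫‖ ≤ C := fun r hr =>
    (norm_sum_le _ _).trans ((Finset.sum_le_sum fun i _ => hle i _).trans (hC r hr))
  have hmvt := hS.norm_image_sub_le_of_norm_hasDerivWithin_le hderiv hbound hs ht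
  calc ∑ i ∈ I, ‖f i t‖ - ∑ i ∈ I, ‖f i s‖
      ≤ ∑ i ∈ I, ⟪e i, f i t⟫ - ∑ i ∈ I, ⟪e i, f i s⟫ :=
        sub_le_sub (Finset.sum_le_sum fun i _ => (het i).ge)
          (Finset.sum_le_sum fun i _ => (le_abs_self _).trans (hle i _))
    _ ≤ C * |t - s| := (le_abs_self _).trans hmvt

variable {γ g : ℝ → R2} {lam : ℝ}

lemma IsW11.sum_norm_convG_sub_le (h : IsW11 γ g) (hlam : 0 < lam) (hL : 0 < clen g) (n : ℕ) :
    ∑ k ∈ Finset.range n, ‖convG lam g γ ((k + 1 : ℕ) / n) - convG lam g γ ((k : ℕ) / n)‖ ≤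
      clen g / (1 + 4 * lam ^ 2) := by
  obtain ⟨Y, hY, hY01, hYγ⟩ := h.exists_arcLength_param hL
  obtain ⟨Z, V, hZ, hV, hZ01, hV01, hZY⟩ := exists_green_solution hlam hY.continuous
  have hVc : Continuous V := continuous_iff_continuousAt.2 fun x => (hV x).continuousAt
  have hm := h.monotone_carc hL
  have hconv : ∀ u ∈ Icc (0:ℝ) 1, convG lam g γ u = -Z (carc g u) := fun u hu => by
    have hcu : carc g u ∈ Icc (0:ℝ) 1 :=
      ⟨by rw [← carc_zero g]; exact hm hu.1, by rw [← carc_one hL.ne']; exact hm hu.2⟩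
    have hYc := hY.continuous
    have hcont : Continuous fun y => Gker lam (y - carc g u) • Y y := by
      unfold Gker
      have := Real.continuous_cosh
      fun_prop
    rw [← hZY _ hcu, ← h.integral_comp_carc hL hcont, convG]
    refine intervalIntegral.integral_congr fun v hv => ?_
    rw [uIcc_of_le zero_le_one] at hv
    rw [hYγ v hv, smul_smul, mul_comm]
  have hV1 := integral_norm_deriv_green_le hlam hY hY01 hZ hV hZ01 hV01
  rw [Real.coe_toNNReal _ hL.le] at hV1
  rw [le_div_iff₀' (by positivity)]
  refine le_trans (mul_le_mul_of_nonneg_left ?_ (by positivity)) hV1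
  rcases Nat.eq_zero_or_pos n with rfl | hn
  · simpa using intervalIntegral.integral_nonneg zero_le_one fun x _ => norm_nonneg (V x)
  have hn' : (0:ℝ) < n := by exact_mod_cast hn
  have hsum := intervalIntegral.sum_integral_adjacent_intervals (f := fun x => ‖V x‖)
    (μ := volume) (a := fun k : ℕ => carc g ((k : ℕ) / n)) (n := n)
    fun k _ => hVc.norm.intervalIntegrable _ _
  simp only [Nat.cast_zero, zero_div, div_self hn'.ne', carc_zero, carc_one hL.ne'] at hsum
  rw [← hsum]
  refine Finset.sum_le_sum fun k hk => ?_
  have hk := Finset.mem_range.1 hk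
  rw [hconv _ (div_mem_Icc hk), hconv _ (div_mem_Icc hk.le), neg_sub_neg, norm_sub_rev,
    ← intervalIntegral.integral_eq_sub_of_hasDerivAt (fun x _ => hZ x)
      (hVc.intervalIntegrable _ _)]
  exact intervalIntegral.norm_integral_le_integral_norm (hm (div_le_succ_div k n))

lemma IsW11.sum_norm_sub_add_Fgrad_le (h : IsW11 γ g) (hlam : 0 < lam) (n : ℕ) :
    ∑ k ∈ Finset.range n, ‖(γ ((k + 1 : ℕ) / n) - γ ((k : ℕ) / n)) + lam ^ 2 •
      (Fgrad lam 2 γ g ((k + 1 : ℕ) / n) - Fgrad lam 2 γ g ((k : ℕ) / n))‖ ≤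
      clen g / (1 + 4 * lam ^ 2) := by
  rcases eq_or_ne (clen g) 0 with hL | hL
  · have := polyLen_le h n
    simp only [polyLen, hL] at this
    simpa only [Fgrad, hL, if_true, sub_self, smul_zero, add_zero, zero_div] using this
  · have hL' : 0 < clen g := hL.symm.lt_of_le
      (intervalIntegral.integral_nonneg zero_le_one fun _ _ => norm_nonneg _)
    refine le_of_eq_of_le (Finset.sum_congr rfl fun k _ => ?_) (h.sum_norm_convG_sub_le hlam hL' n)
    rw [← norm_neg]
    congr 1
    have hl : lam ^ 2 ≠ 0 := by positivity
    simp only [Fgrad, hL, if_false, sub_self, Real.rpow_zero]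
    rw [← smul_sub, smul_smul, mul_neg, mul_one_div_cancel hl]
    module

variable {T : ℝ} {X G : ℝ → ℝ → R2}

lemma IsGFSol.supControlled (hX : IsGFSol lam 2 (Ico 0 T) X G) (hlam : 0 < lam) {t : ℝ}
    (ht : t < T) :
    SupControlled (fun n s => exp (s / lam ^ 2) * polyLen (X s) n)
      (fun s => exp (s / lam ^ 2) * clen (G s)) (1 / (lam ^ 2 * (1 + 4 * lam ^ 2))) t := by
  have hsub : Icc 0 t ⊆ Ico 0 T := fun s hs => ⟨hs.1, hs.2.trans_lt ht⟩
  have hl : lam ^ 2 ≠ 0 := by positivity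
  set f : ℕ → ℕ → ℝ → R2 := fun n k s =>
    exp (s / lam ^ 2) • (X s ((k + 1 : ℕ) / n) - X s ((k : ℕ) / n)) with hf
  set f' : ℕ → ℕ → ℝ → R2 := fun n k s =>
    (exp (s / lam ^ 2) / lam ^ 2) • ((X s ((k + 1 : ℕ) / n) - X s ((k : ℕ) / n)) + lam ^ 2 •
      (Fgrad lam 2 (X s) (G s) ((k + 1 : ℕ) / n) - Fgrad lam 2 (X s) (G s) ((k : ℕ) / n))) with hf'
  have hderiv : ∀ n k, ∀ s ∈ Icc 0 t, HasDerivWithinAt (f n k) (f' n k s) (Icc 0 t) s := by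
    intro n k s hs
    have hd := ((hX.2 s (hsub hs) ((k + 1 : ℕ) / n)).sub (hX.2 s (hsub hs) ((k : ℕ) / n))).mono hsub
    have he : HasDerivWithinAt (fun s => exp (s / lam ^ 2)) (exp (s / lam ^ 2) * (1 / lam ^ 2))
        (Icc 0 t) s := (((hasDerivAt_id s).div_const _).exp).hasDerivWithinAt
    refine (he.smul hd).congr_deriv ?_
    simp only [hf', Pi.sub_apply, smul_add, smul_smul, div_mul_cancel₀ _ hl, mul_one_div]
    abel
  have hp : ∀ n s, exp (s / lam ^ 2) * polyLen (X s) n = ∑ k ∈ Finset.range n, ‖f n k s‖ := by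
    intro n s
    simp only [polyLen, Finset.mul_sum, hf, norm_smul, Real.norm_eq_abs, Real.abs_exp]
  constructor
  · positivity
  · intro n
    simp only [hp]
    exact continuousOn_finsetSum _ fun k _ s hs => (hderiv n k s hs).continuousWithinAt.norm
  · intro s hs
    have hlub := isLUB_polyLen (hX.1 s (hsub hs))
    refine ⟨?_, fun b hb => ?_⟩
    · rintro _ ⟨n, rfl⟩
      exact mul_le_mul_of_nonneg_left (hlub.1 ⟨n, rfl⟩) (exp_pos _).le
    · rw [← le_div_iff₀' (exp_pos _)]
      refine hlub.2 ?_
      rintro _ ⟨n, rfl⟩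
      rw [le_div_iff₀' (exp_pos _)]
      exact hb ⟨n, rfl⟩
  · intros
    exact mul_nonneg (exp_pos _).le
      (intervalIntegral.integral_nonneg zero_le_one fun _ _ => norm_nonneg _)
  · intro s hs r hr M hM n
    simp only [hp]
    have hu : uIcc s r ⊆ Icc 0 t := OrdConnected.uIcc_subset ordConnected_Icc hs hr
    refine sum_norm_sub_sum_norm_le (convex_uIcc s r)
      (fun k _ q hq => (hderiv n k q (hu hq)).mono hu) (fun q hq => ?_) left_mem_uIcc right_mem_uIcc
    have h1 := (hX.1 q (hsub (hu hq))).sum_norm_sub_add_Fgrad_le hlam n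
    calc ∑ k ∈ Finset.range n, ‖f' n k q‖
        ≤ exp (q / lam ^ 2) / lam ^ 2 * (clen (G q) / (1 + 4 * lam ^ 2)) := by
          refine le_trans (le_of_eq ?_) (mul_le_mul_of_nonneg_left h1 (by positivity))
          rw [Finset.mul_sum]
          refine Finset.sum_congr rfl fun k _ => ?_
          rw [hf', norm_smul, Real.norm_of_nonneg (by positivity)]
      _ = 1 / (lam ^ 2 * (1 + 4 * lam ^ 2)) * (exp (q / lam ^ 2) * clen (G q)) := by
          field_simp
      _ ≤ 1 / (lam ^ 2 * (1 + 4 * lam ^ 2)) * M :=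
          mul_le_mul_of_nonneg_left (hM q hq) (by positivity)

end FlowEstimate

/-- exponential decay of length along (GF2):
`L(X(·,t)) ≤ L(X(·,0)) e^{-4t/(1+8λ²)}` for solutions that are `C¹` into `W^{1,1}`. -/
theorem statement13 (lam T : ℝ) (hlam : 0 < lam) (X g D Dg : ℝ → ℝ → R2)
    (hX : IsGFSol lam 2 (Set.Ico 0 T) X g)
    (hC1 : IsC1W11 (Set.Ico 0 T) X g D Dg) :
    ∀ t ∈ Set.Ico (0:ℝ) T, clen (g t) ≤ clen (g 0) * Real.exp (-4*t/(1+8*lam^2)) := by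
  intro t ht
  have h := (hX.supControlled hlam ht.2).le_mul_exp ht.1
  simp only [zero_div, Real.exp_zero, one_mul] at h
  have hL : 0 ≤ clen (g 0) :=
    intervalIntegral.integral_nonneg zero_le_one fun _ _ => norm_nonneg _
  have he : clen (g t) ≤
      clen (g 0) * Real.exp (1 / (lam ^ 2 * (1 + 4 * lam ^ 2)) * t - t / lam ^ 2) := by
    rw [Real.exp_sub, ← mul_div_assoc, le_div_iff₀' (Real.exp_pos _)]
    exact h
  refine he.trans (mul_le_mul_of_nonneg_left (Real.exp_le_exp.2 ?_) hL)
  have hexp : 1 / (lam ^ 2 * (1 + 4 * lam ^ 2)) * t - t / lam ^ 2 =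
      -(4 * t / (1 + 4 * lam ^ 2)) := by
    field_simp
    ring
  rw [hexp, neg_mul, neg_div, neg_le_neg_iff]
  have := ht.1
  gcongr
  norm_num
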